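/- arXiv:1207.5440 — 2 statements merged into one kernel-verified Lean document; each statement's English description precedes it below -/
import Mathlib

section
/- Let U ⊆ ℝ³ be a contractible open set and let c, d : U → ℝ be smooth functions satisfying Xd + Yc = 0 on U. Then there exist smooth functions a, b : U → ℝ such that c = X²b − (XY + Z)a and d = Y²a − (YX − Z)b on U (local exactness of the Rumin complex for the Heisenberg distribution in degree two). -/
/-- Heisenberg operator `X = ∂/∂x` on `ℝ³` with coordinates `(x, y, t)`. -/
noncomputable def opX (f : (Fin 3 → ℝ) → ℝ) : (Fin 3 → ℝ) → ℝ :=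
  fun p => fderiv ℝ f p ![1, 0, 0]

/-- Heisenberg operator `Y = ∂/∂t + x ∂/∂y` on `ℝ³`. -/
noncomputable def opY (f : (Fin 3 → ℝ) → ℝ) : (Fin 3 → ℝ) → ℝ :=
  fun p => fderiv ℝ f p ![0, p 0, 1]

/-- Heisenberg operator `Z = [X, Y] = ∂/∂y` on `ℝ³`. -/
noncomputable def opZ (f : (Fin 3 → ℝ) → ℝ) : (Fin 3 → ℝ) → ℝ :=
  fun p => fderiv ℝ f p ![0, 1, 0]

open Set Topology
open scoped ContDiff Manifold

universe u

theorem IsOpen.exists_continuous_pos_ball_subset {E : Type*} [PseudoMetricSpace E] {U : Set E}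
    (hU : IsOpen U) :
    ∃ δ : E → ℝ, Continuous δ ∧ ∀ x ∈ U, 0 < δ x ∧ Metric.ball x (δ x) ⊆ U := by
  rcases Uᶜ.eq_empty_or_nonempty with h | h
  · rw [compl_empty_iff] at h
    exact ⟨fun _ => 1, continuous_const, fun x _ => ⟨one_pos, by simp [h]⟩⟩
  · refine ⟨fun x => Metric.infDist x Uᶜ, Metric.continuous_infDist_pt _, fun x hx => ⟨?_, ?_⟩⟩
    · exact (hU.isClosed_compl.notMem_iff_infDist_pos h).1 (by simpa using hx)
    · simpa using (Metric.ball_infDist_compl_subset (s := U) (x := x))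

theorem contDiffOn_extend_of_contMDiff {E F : Type*} [NormedAddCommGroup E] [NormedSpace ℝ E]
    [NormedAddCommGroup F] [NormedSpace ℝ F] {n : ℕ∞} {V : TopologicalSpace.Opens E} {g : V → F}
    (hg : ContMDiff 𝓘(ℝ, E) 𝓘(ℝ, F) n g) :
    ∃ G : E → F, ContDiffOn ℝ n G V ∧ ∀ x : V, G x = g x := by
  classical
  refine ⟨fun x => if h : x ∈ V then g ⟨x, h⟩ else 0, fun x hx => ?_, fun x => by simp⟩
  refine (contMDiffAt_iff_contDiffAt.1 ?_).contDiffWithinAt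
  refine (contMDiffAt_subtype_iff (x := (⟨x, hx⟩ : V))).1 ?_
  simpa using hg ⟨x, hx⟩

/-- A contractible open subset of a finite-dimensional space is smoothly contractible. -/
theorem IsOpen.exists_contDiffOn_contraction {E : Type*} [NormedAddCommGroup E] [NormedSpace ℝ E]
    [FiniteDimensional ℝ E] {U : Set E} (hU : IsOpen U) [ContractibleSpace U] :
    ∃ (p₀ : E) (H : E × ℝ → E), ContDiffOn ℝ ∞ H (U ×ˢ univ) ∧ MapsTo H (U ×ˢ univ) U ∧
      (∀ p ∈ U, H (p, 1) = p) ∧ ∀ p ∈ U, H (p, 0) = p₀ := by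
  obtain ⟨δ, hδ, hδU⟩ := hU.exists_continuous_pos_ball_subset
  obtain ⟨p₀, ⟨Φ⟩⟩ := id_nullhomotopic U
  let V : TopologicalSpace.Opens (E × ℝ) := ⟨U ×ˢ univ, hU.prod isOpen_univ⟩
  have hmem : ∀ p ∈ U, ∀ s : ℝ, (p, s) ∈ V := fun p hp s => ⟨hp, mem_univ s⟩
  let ρ : V → U := fun q => ⟨q.1.1, q.2.1⟩
  have hρ : Continuous ρ := by fun_prop
  let τ : V → ℝ := fun q => q.1.2
  have hτ : Continuous τ := by fun_prop
  let h : V → U := fun q => Φ (projIcc 0 1 zero_le_one (2 - 3 * τ q), ρ q)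
  have hh : Continuous h := by fun_prop
  have h_right : ∀ q : V, 2 / 3 < τ q → h q = ρ q := fun q hq => by
    simp only [h]
    rw [projIcc_of_le_left _ (by linarith)]
    exact Φ.map_zero_left _
  have h_left : ∀ q : V, τ q < 1 / 3 → h q = p₀ := fun q hq => by
    simp only [h]
    rw [projIcc_of_right_le _ (by linarith)]
    exact Φ.map_one_left _
  have : LocallyCompactSpace V := V.isOpen.locallyCompactSpace
  have hsmooth : ContMDiffOn 𝓘(ℝ, E × ℝ) 𝓘(ℝ, E) ∞ (fun q => (h q : E))
      (τ ⁻¹' (Iio (1 / 3) ∪ Ioi (2 / 3))) := by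
    rintro q (hq | hq)
    · refine (contMDiffAt_const (c := (p₀ : E))).congr_of_eventuallyEq ?_ |>.contMDiffWithinAt
      filter_upwards [(isOpen_Iio.preimage hτ).mem_nhds hq] with q' hq'
      rw [h_left q' hq']
    · have hval : ContMDiff 𝓘(ℝ, E × ℝ) 𝓘(ℝ, E) ∞ (fun q : V => (q : E × ℝ).1) :=
        contDiff_fst.contMDiff.comp contMDiff_subtype_val
      refine (hval q).congr_of_eventuallyEq ?_ |>.contMDiffWithinAt
      filter_upwards [(isOpen_Ioi.preimage hτ).mem_nhds hq] with q' hq'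
      rw [h_right q' hq']
  have hS : IsClosed (τ ⁻¹' (Iic 0 ∪ Ici 1)) := (isClosed_Iic.union isClosed_Ici).preimage hτ
  have hN : τ ⁻¹' (Iio (1 / 3) ∪ Ioi (2 / 3)) ∈ 𝓝ˢ (τ ⁻¹' (Iic 0 ∪ Ici 1)) := by
    refine ((isOpen_Iio.union isOpen_Ioi).preimage hτ).mem_nhdsSet.2 (preimage_mono ?_)
    rintro s (hs | hs)
    · left; simp only [mem_Iic, mem_Iio] at *; linarith
    · right; simp only [mem_Ici, mem_Ioi] at *; linarith
  obtain ⟨g, hgδ, hgS, -⟩ := Continuous.exists_contMDiff_approx_and_eqOn 𝓘(ℝ, E × ℝ) ⊤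
    (f := fun q => (h q : E)) (ε := fun q => δ (h q)) (by fun_prop) (by fun_prop)
    (fun q => (hδU _ (h q).2).1) hS hN hsmooth
  obtain ⟨H, hH, hHg⟩ := contDiffOn_extend_of_contMDiff g.contMDiff
  refine ⟨p₀, H, hH, fun q hq => ?_, fun p hp => ?_, fun p hp => ?_⟩
  · rw [hHg ⟨q, hq⟩]
    exact (hδU _ (h _).2).2 (hgδ _)
  · have hmemS : (⟨(p, 1), hmem p hp 1⟩ : V) ∈ τ ⁻¹' (Iic 0 ∪ Ici 1) := by simp [τ]
    exact (hHg ⟨(p, 1), hmem p hp 1⟩).trans <| (hgS hmemS).trans <|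
      congrArg Subtype.val (h_right _ (by norm_num [τ]))
  · have hmemS : (⟨(p, 0), hmem p hp 0⟩ : V) ∈ τ ⁻¹' (Iic 0 ∪ Ici 1) := by simp [τ]
    exact (hHg ⟨(p, 0), hmem p hp 0⟩).trans <| (hgS hmemS).trans <|
      congrArg Subtype.val (h_left _ (by norm_num [τ]))

theorem hasFDerivAt_intervalIntegral_of_contDiffOn {E G : Type*}
    [NormedAddCommGroup E] [NormedSpace ℝ E] [FiniteDimensional ℝ E]
    [NormedAddCommGroup G] [NormedSpace ℝ G]
    {U : Set E} (hU : IsOpen U) {F : E × ℝ → G} (hF : ContDiffOn ℝ 1 F (U ×ˢ univ))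
    (a b : ℝ) {p : E} (hp : p ∈ U) :
    HasFDerivAt (fun p => ∫ s in a..b, F (p, s))
      (∫ s in a..b, (fderiv ℝ F (p, s)).comp (.inl ℝ E ℝ)) p := by
  have hV : IsOpen (U ×ˢ (univ : Set ℝ)) := hU.prod isOpen_univ
  have hF' : ContinuousOn (fun q => (fderiv ℝ F q).comp (.inl ℝ E ℝ)) (U ×ˢ univ) :=
    (hF.continuousOn_fderiv_of_isOpen hV le_rfl).clm_comp continuousOn_const
  have hsliceF : ∀ x ∈ U, Continuous fun s : ℝ => F (x, s) := fun x hx =>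
    hF.continuousOn.comp_continuous (by fun_prop) fun s => ⟨hx, trivial⟩
  have hsliceF' : Continuous fun s : ℝ => (fderiv ℝ F (p, s)).comp (.inl ℝ E ℝ) :=
    hF'.comp_continuous (f := fun s => (p, s)) (by fun_prop) fun s => ⟨hp, trivial⟩
  obtain ⟨r, hr, hrU⟩ := Metric.nhds_basis_closedBall.mem_iff.1 (hU.mem_nhds hp)
  have : ProperSpace E := FiniteDimensional.proper_real E
  obtain ⟨C, hC⟩ := ((isCompact_closedBall p r).prod
    (isCompact_uIcc (a := a) (b := b))).exists_bound_of_continuousOn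
    (hF'.mono (prod_mono hrU (subset_univ _)))
  refine intervalIntegral.hasFDerivAt_integral_of_dominated_of_fderiv_le (𝕜 := ℝ)
    (F := fun x s => F (x, s)) (F' := fun x s => (fderiv ℝ F (x, s)).comp (.inl ℝ E ℝ))
    (bound := fun _ => C)
    (Metric.closedBall_mem_nhds p hr) ?_ ?_ ?_ ?_ ?_ ?_
  · filter_upwards [hU.mem_nhds hp] with x hx
    exact (hsliceF x hx).aestronglyMeasurable
  · exact (hsliceF p hp).intervalIntegrable _ _
  · exact hsliceF'.aestronglyMeasurable
  · exact .of_forall fun s hs x hx => hC (x, s) ⟨hx, uIoc_subset_uIcc hs⟩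
  · exact intervalIntegrable_const
  · refine .of_forall fun s _ x hx => ?_
    have hd : HasFDerivAt F (fderiv ℝ F (x, s)) (x, s) :=
      ((hF.contDiffAt (hV.mem_nhds ⟨hrU hx, trivial⟩)).differentiableAt one_ne_zero).hasFDerivAt
    exact hd.comp x (hasFDerivAt_prodMk_left x s)

theorem contDiffOn_intervalIntegral {E G : Type u}
    [NormedAddCommGroup E] [NormedSpace ℝ E] [FiniteDimensional ℝ E]
    [NormedAddCommGroup G] [NormedSpace ℝ G] {U : Set E} (hU : IsOpen U) {F : E × ℝ → G}
    (hF : ContDiffOn ℝ ∞ F (U ×ˢ univ)) (a b : ℝ) :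
    ContDiffOn ℝ ∞ (fun p => ∫ s in a..b, F (p, s)) U := by
  refine contDiffOn_infty.2 fun n => ?_
  induction n generalizing G with
  | zero =>
    refine contDiffOn_zero.2 fun p hp => ContinuousAt.continuousWithinAt ?_
    exact (hasFDerivAt_intervalIntegral_of_contDiffOn hU
      (hF.of_le (by simp)) a b hp).continuousAt
  | succ n ih =>
    have hderiv := fun p hp => hasFDerivAt_intervalIntegral_of_contDiffOn hU
      (hF.of_le (by simp)) a b (p := p) hp
    rw [Nat.cast_succ, contDiffOn_succ_iff_fderiv_of_isOpen hU]
    refine ⟨fun p hp => (hderiv p hp).differentiableAt.differentiableWithinAt, by simp, ?_⟩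
    refine (ih (F := fun q => (fderiv ℝ F q).comp (.inl ℝ E ℝ)) ?_).congr
      fun p hp => (hderiv p hp).fderiv
    exact (hF.fderiv_of_isOpen (hU.prod isOpen_univ) le_rfl).clm_comp contDiffOn_const

/-- The pullback of a closed two-form is closed. -/
theorem fderiv_pullback_cyclic {E M : Type*} [NormedAddCommGroup E] [NormedSpace ℝ E]
    [NormedAddCommGroup M] [NormedSpace ℝ M] {B : E → E →L[ℝ] E →L[ℝ] ℝ} {H : M → E} {q : M}
    (hB : DifferentiableAt ℝ B (H q)) (hH : ContDiffAt ℝ 2 H q)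
    (hskew : ∀ u v, B (H q) u v = -B (H q) v u)
    (hclosed : ∀ u v w, fderiv ℝ B (H q) u v w + fderiv ℝ B (H q) v w u
      + fderiv ℝ B (H q) w u v = 0) (ξ η ζ : M) :
    fderiv ℝ (fun q => B (H q) (fderiv ℝ H q η) (fderiv ℝ H q ζ)) q ξ
      + fderiv ℝ (fun q => B (H q) (fderiv ℝ H q ζ) (fderiv ℝ H q ξ)) q η
      + fderiv ℝ (fun q => B (H q) (fderiv ℝ H q ξ) (fderiv ℝ H q η)) q ζ = 0 := by
  have hdH : DifferentiableAt ℝ H q := hH.differentiableAt two_ne_zero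
  have hd2H : DifferentiableAt ℝ (fderiv ℝ H) q :=
    (hH.fderiv_right (m := 1) (by norm_num)).differentiableAt one_ne_zero
  have hsymm : ∀ x y, fderiv ℝ (fderiv ℝ H) q x y = fderiv ℝ (fderiv ℝ H) q y x :=
    hH.isSymmSndFDerivAt (by simp)
  have hterm : ∀ x y z : M,
      fderiv ℝ (fun q => B (H q) (fderiv ℝ H q y) (fderiv ℝ H q z)) q x =
        fderiv ℝ B (H q) (fderiv ℝ H q x) (fderiv ℝ H q y) (fderiv ℝ H q z)
          + B (H q) (fderiv ℝ (fderiv ℝ H) q x y) (fderiv ℝ H q z)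
          + B (H q) (fderiv ℝ H q y) (fderiv ℝ (fderiv ℝ H) q x z) := by
    intro x y z
    have hy := hd2H.hasFDerivAt.clm_apply (hasFDerivAt_const y q)
    have hz := hd2H.hasFDerivAt.clm_apply (hasFDerivAt_const z q)
    have hBH : HasFDerivAt (fun q => B (H q)) ((fderiv ℝ B (H q)).comp (fderiv ℝ H q)) q :=
      HasFDerivAt.comp (g := B) q hB.hasFDerivAt hdH.hasFDerivAt
    rw [((hBH.clm_apply hy).clm_apply hz).fderiv]
    simp
    ring
  rw [hterm, hterm, hterm, hsymm η ξ, hsymm ζ ξ, hsymm ζ η,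
    hskew (fderiv ℝ (fderiv ℝ H) q ξ η), hskew (fderiv ℝ (fderiv ℝ H) q ξ ζ),
    hskew (fderiv ℝ (fderiv ℝ H) q η ζ)]
  linarith [hclosed (fderiv ℝ H q ξ) (fderiv ℝ H q η) (fderiv ℝ H q ζ)]

/-- Poincaré lemma for two-forms, given a smooth contraction `H` of `U`. -/
theorem exists_contDiffOn_primitive_two_form {E : Type u} [NormedAddCommGroup E] [NormedSpace ℝ E]
    [FiniteDimensional ℝ E] {U : Set E} (hU : IsOpen U) {p₀ : E} {H : E × ℝ → E}
    (hH : ContDiffOn ℝ ∞ H (U ×ˢ univ)) (hHU : MapsTo H (U ×ˢ univ) U)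
    (hH₁ : ∀ p ∈ U, H (p, 1) = p) (hH₀ : ∀ p ∈ U, H (p, 0) = p₀)
    {B : E → E →L[ℝ] E →L[ℝ] ℝ} (hB : ContDiffOn ℝ ∞ B U)
    (hskew : ∀ p ∈ U, ∀ u v, B p u v = -B p v u)
    (hclosed : ∀ p ∈ U, ∀ u v w, fderiv ℝ B p u v w + fderiv ℝ B p v w u
      + fderiv ℝ B p w u v = 0) :
    ∃ A : E → E →L[ℝ] ℝ, ContDiffOn ℝ ∞ A U ∧
      ∀ p ∈ U, ∀ u v, fderiv ℝ A p u v - fderiv ℝ A p v u = B p u v := by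
  have hV : IsOpen (U ×ˢ (univ : Set ℝ)) := hU.prod isOpen_univ
  have hdH : ContDiffOn ℝ ∞ (fderiv ℝ H) (U ×ˢ univ) := hH.fderiv_of_isOpen hV le_rfl
  have hBH : ContDiffOn ℝ ∞ (fun q => B (H q)) (U ×ˢ univ) := hB.comp hH hHU
  let W : E × ℝ → (E × ℝ) → (E × ℝ) → ℝ :=
    fun q ξ η => B (H q) (fderiv ℝ H q ξ) (fderiv ℝ H q η)
  have hW : ∀ ξ η, ContDiffOn ℝ ∞ (fun q => W q ξ η) (U ×ˢ univ) := fun ξ η =>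
    (hBH.clm_apply (hdH.clm_apply contDiffOn_const)).clm_apply (hdH.clm_apply contDiffOn_const)
  let F : E × ℝ → E →L[ℝ] ℝ := fun q =>
    (B (H q) (fderiv ℝ H q (0, 1))).comp ((fderiv ℝ H q).comp (.inl ℝ E ℝ))
  have hF : ContDiffOn ℝ ∞ F (U ×ˢ univ) :=
    (hBH.clm_apply (hdH.clm_apply contDiffOn_const)).clm_comp (hdH.clm_comp contDiffOn_const)
  refine ⟨fun p => ∫ s in (0 : ℝ)..1, F (p, s), contDiffOn_intervalIntegral hU hF 0 1,
    fun p hp u v => ?_⟩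
  have hmem : ∀ s : ℝ, (p, s) ∈ U ×ˢ (univ : Set ℝ) := fun s => ⟨hp, mem_univ s⟩
  have hdF : ContinuousOn (fderiv ℝ F) (U ×ˢ univ) :=
    hF.continuousOn_fderiv_of_isOpen hV (by simp)
  have hdFp : Continuous fun s : ℝ => fderiv ℝ F (p, s) :=
    hdF.comp_continuous (by fun_prop) hmem
  have hFderiv : ∀ x y, fderiv ℝ (fun p => ∫ s in (0 : ℝ)..1, F (p, s)) p x y
      = ∫ s in (0 : ℝ)..1, fderiv ℝ F (p, s) (x, 0) y := by
    intro x y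
    rw [(hasFDerivAt_intervalIntegral_of_contDiffOn hU (hF.of_le (by simp)) 0 1 hp).fderiv,
      ContinuousLinearMap.intervalIntegral_apply, ContinuousLinearMap.intervalIntegral_apply]
    · simp
    · exact (Continuous.intervalIntegrable (by fun_prop) _ _)
    · exact (Continuous.intervalIntegrable (by fun_prop) _ _)
  have hFW : ∀ s x y, fderiv ℝ F (p, s) (x, 0) y
      = fderiv ℝ (fun q => W q (0, 1) (y, 0)) (p, s) (x, 0) := by
    intro s x y
    have h := ((hF.contDiffAt (hV.mem_nhds (hmem s))).differentiableAt
      (by simp)).hasFDerivAt.clm_apply (hasFDerivAt_const y (p, s))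
    have h' : (fun q => W q (0, 1) (y, 0)) = fun q => F q y := by ext q; simp [W, F]
    rw [h', h.fderiv]
    simp
  have hcyc : ∀ s, fderiv ℝ F (p, s) (u, 0) v - fderiv ℝ F (p, s) (v, 0) u
      = fderiv ℝ (fun q => W q (u, 0) (v, 0)) (p, s) (0, 1) := by
    intro s
    have hHs := hHU (hmem s)
    have h := fderiv_pullback_cyclic (B := B) (H := H) (q := (p, s))
      ((hB.contDiffAt (hU.mem_nhds hHs)).differentiableAt (by simp))
      ((hH.contDiffAt (hV.mem_nhds (hmem s))).of_le (WithTop.coe_le_coe.2 le_top))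
      (hskew _ hHs) (hclosed _ hHs) (0, 1) (u, 0) (v, 0)
    have h' : (fun q => W q (0, 1) (v, 0)) =ᶠ[𝓝 (p, s)] fun q => -W q (v, 0) (0, 1) := by
      filter_upwards [hV.mem_nhds (hmem s)] with q hq
      exact hskew _ (hHU hq) _ _
    rw [hFW, hFW]
    have h'' := congrArg (fun L : E × ℝ →L[ℝ] ℝ => L (u, 0)) h'.fderiv_eq
    simp only [fderiv_fun_neg, W, neg_apply] at h h'' ⊢
    linarith
  have hFTC : ∀ s ∈ uIcc (0 : ℝ) 1, HasDerivAt (fun s => W (p, s) (u, 0) (v, 0))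
      (fderiv ℝ (fun q => W q (u, 0) (v, 0)) (p, s) (0, 1)) s := fun s _ => by
    have hpath : HasDerivAt (fun s : ℝ => (p, s)) ((0 : E), (1 : ℝ)) s :=
      (hasDerivAt_const s p).prodMk (hasDerivAt_id s)
    exact HasFDerivAt.comp_hasDerivAt s (((hW (u, 0) (v, 0)).contDiffAt
      (hV.mem_nhds (hmem s))).differentiableAt (by simp)).hasFDerivAt hpath
  have hslice : ∀ s x, fderiv ℝ H (p, s) (x, 0) = fderiv ℝ (fun p => H (p, s)) p x := by
    intro s x
    have h : HasFDerivAt (fun p => H (p, s)) ((fderiv ℝ H (p, s)).comp (.inl ℝ E ℝ)) p :=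
      ((hH.contDiffAt (hV.mem_nhds (hmem s))).differentiableAt
        (by simp)).hasFDerivAt.comp p (hasFDerivAt_prodMk_left p s)
    simp [h.fderiv]
  have hone : ∀ x, fderiv ℝ H (p, 1) (x, 0) = x := fun x => by
    have h : (fun p => H (p, (1 : ℝ))) =ᶠ[𝓝 p] id := by
      filter_upwards [hU.mem_nhds hp] with p' hp' using hH₁ p' hp'
    rw [hslice, h.fderiv_eq, fderiv_id, ContinuousLinearMap.id_apply]
  have hzero : ∀ x, fderiv ℝ H (p, 0) (x, 0) = 0 := fun x => by
    have h : (fun p => H (p, (0 : ℝ))) =ᶠ[𝓝 p] fun _ => p₀ := by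
      filter_upwards [hU.mem_nhds hp] with p' hp' using hH₀ p' hp'
    rw [hslice, h.fderiv_eq, fderiv_const_apply, zero_apply]
  rw [hFderiv, hFderiv, ← intervalIntegral.integral_sub
    (Continuous.intervalIntegrable (by fun_prop) _ _)
    (Continuous.intervalIntegrable (by fun_prop) _ _)]
  simp only [hcyc]
  rw [intervalIntegral.integral_eq_sub_of_hasDerivAt hFTC]
  · simp [W, hone, hzero, hH₁ p hp]
  · simp only [← hcyc]
    exact Continuous.intervalIntegrable (by fun_prop) _ _

/-- Poincaré lemma: closed two-forms on a contractible open set are exact. -/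
theorem exists_contDiffOn_primitive_of_contractible {E : Type u}
    [NormedAddCommGroup E] [NormedSpace ℝ E] [FiniteDimensional ℝ E]
    {U : Set E} (hU : IsOpen U) [ContractibleSpace U]
    {B : E → E →L[ℝ] E →L[ℝ] ℝ} (hB : ContDiffOn ℝ ∞ B U)
    (hskew : ∀ p ∈ U, ∀ u v, B p u v = -B p v u)
    (hclosed : ∀ p ∈ U, ∀ u v w, fderiv ℝ B p u v w + fderiv ℝ B p v w u
      + fderiv ℝ B p w u v = 0) :
    ∃ A : E → E →L[ℝ] ℝ, ContDiffOn ℝ ∞ A U ∧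
      ∀ p ∈ U, ∀ u v, fderiv ℝ A p u v - fderiv ℝ A p v u = B p u v := by
  obtain ⟨p₀, H, hH, hHU, hH₁, hH₀⟩ := hU.exists_contDiffOn_contraction
  exact exists_contDiffOn_primitive_two_form hU hH hHU hH₁ hH₀ hB hskew hclosed

/-- The two-form `dxᵢ ∧ dxⱼ` on `ℝ³`, as a bilinear map. -/
noncomputable def coordWedge (i j : Fin 3) : (Fin 3 → ℝ) →L[ℝ] (Fin 3 → ℝ) →L[ℝ] ℝ :=
  (ContinuousLinearMap.proj i : (Fin 3 → ℝ) →L[ℝ] ℝ).smulRight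
      (ContinuousLinearMap.proj j : (Fin 3 → ℝ) →L[ℝ] ℝ)
    - (ContinuousLinearMap.proj j : (Fin 3 → ℝ) →L[ℝ] ℝ).smulRight
      (ContinuousLinearMap.proj i : (Fin 3 → ℝ) →L[ℝ] ℝ)

theorem coordWedge_apply (i j : Fin 3) (u v : Fin 3 → ℝ) :
    coordWedge i j u v = u i * v j - u j * v i := by
  simp [coordWedge]

theorem map_fin_three (L : (Fin 3 → ℝ) →L[ℝ] ℝ) (u : Fin 3 → ℝ) :
    L u = u 0 * L ![1, 0, 0] + u 1 * L ![0, 1, 0] + u 2 * L ![0, 0, 1] := by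
  have hu : u = u 0 • ![1, 0, 0] + u 1 • ![0, 1, 0] + u 2 • ![0, 0, 1] := by
    ext i; fin_cases i <;> simp
  conv_lhs => rw [hu]
  simp only [map_add, map_smul, smul_eq_mul]

/-- The two-form `c dx ∧ θ - d dt ∧ θ` with `θ = dy - x dt`. -/
noncomputable def ruminTwoForm (c d : (Fin 3 → ℝ) → ℝ) (p : Fin 3 → ℝ) :
    (Fin 3 → ℝ) →L[ℝ] (Fin 3 → ℝ) →L[ℝ] ℝ :=
  c p • coordWedge 0 1 - (p 0 * c p) • coordWedge 0 2 + d p • coordWedge 1 2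

set_option maxSynthPendingDepth 5 in
theorem ruminTwoForm_closed {c d : (Fin 3 → ℝ) → ℝ} {p : Fin 3 → ℝ}
    (hc : DifferentiableAt ℝ c p) (hd : DifferentiableAt ℝ d p) (hcd : opX d p + opY c p = 0)
    (u v w : Fin 3 → ℝ) :
    fderiv ℝ (ruminTwoForm c d) p u v w + fderiv ℝ (ruminTwoForm c d) p v w u
      + fderiv ℝ (ruminTwoForm c d) p w u v = 0 := by
  have hx : HasFDerivAt (fun p : Fin 3 → ℝ => p 0)
    (ContinuousLinearMap.proj 0 : (Fin 3 → ℝ) →L[ℝ] ℝ) p := hasFDerivAt_apply 0 p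
  have h : HasFDerivAt (ruminTwoForm c d) _ p :=
    ((hc.hasFDerivAt.smul_const (coordWedge 0 1)).sub
      ((hx.mul hc.hasFDerivAt).smul_const (coordWedge 0 2))).add
      (hd.hasFDerivAt.smul_const (coordWedge 1 2))
  have hY := map_fin_three (fderiv ℝ c p) ![0, p 0, 1]
  simp only [opX, opY] at hcd
  rw [hY] at hcd
  rw [h.fderiv]
  simp only [add_apply, sub_apply,
    ContinuousLinearMap.smulRight_apply, smul_apply, smul_eq_mul,
    coordWedge_apply, ContinuousLinearMap.proj_apply, map_fin_three (fderiv ℝ c p) u,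
    map_fin_three (fderiv ℝ c p) v, map_fin_three (fderiv ℝ c p) w,
    map_fin_three (fderiv ℝ d p) u, map_fin_three (fderiv ℝ d p) v,
    map_fin_three (fderiv ℝ d p) w]
  simp at hcd
  linear_combination (u 0 * (v 1 * w 2 - v 2 * w 1) - u 1 * (v 0 * w 2 - v 2 * w 0)
    + u 2 * (v 0 * w 1 - v 1 * w 0)) * hcd

set_option maxSynthPendingDepth 5 in
theorem contDiffOn_ruminTwoForm {c d : (Fin 3 → ℝ) → ℝ} {U : Set (Fin 3 → ℝ)}
    (hc : ContDiffOn ℝ ∞ c U) (hd : ContDiffOn ℝ ∞ d U) : ContDiffOn ℝ ∞ (ruminTwoForm c d) U :=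
  ((hc.smul contDiffOn_const).sub
    (((contDiff_apply ℝ ℝ 0).contDiffOn.mul hc).smul contDiffOn_const)).add
      (hd.smul contDiffOn_const)

theorem heisenberg_rumin_exact_degree_two
    (U : Set (Fin 3 → ℝ)) (hU : IsOpen U) (hUc : ContractibleSpace U)
    (c d : (Fin 3 → ℝ) → ℝ)
    (hc : ContDiffOn ℝ (⊤ : ℕ∞) c U) (hd : ContDiffOn ℝ (⊤ : ℕ∞) d U)
    (hcd : ∀ p ∈ U, opX d p + opY c p = 0) :
    ∃ a b : (Fin 3 → ℝ) → ℝ, ContDiffOn ℝ (⊤ : ℕ∞) a U ∧ ContDiffOn ℝ (⊤ : ℕ∞) b U ∧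
      ∀ p ∈ U,
        c p = opX (opX b) p - (opX (opY a) p + opZ a p) ∧
        d p = opY (opY a) p - (opY (opX b) p - opZ b p) := by
  have hYvec : ContDiff ℝ ∞ (fun p : Fin 3 → ℝ => ![0, p 0, 1]) := by
    refine contDiff_pi.2 fun i => ?_
    fin_cases i <;> simp [contDiff_const, contDiff_apply]
  obtain ⟨A, hA, hAB⟩ := exists_contDiffOn_primitive_of_contractible hU
    (contDiffOn_ruminTwoForm hc hd)
    (fun p _ u v => by simp [ruminTwoForm, coordWedge_apply]; ring)
    (fun p hp => ruminTwoForm_closed ((hc.contDiffAt (hU.mem_nhds hp)).differentiableAt (by simp))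
      ((hd.contDiffAt (hU.mem_nhds hp)).differentiableAt (by simp)) (hcd p hp))
  have hAe : ∀ e, ContDiffOn ℝ ∞ (fun p => A p e) U := fun e => hA.clm_apply contDiffOn_const
  have hAY : ContDiffOn ℝ ∞ (fun p => A p ![0, p 0, 1]) U := hA.clm_apply hYvec.contDiffOn
  have hAdiff : ∀ p ∈ U, DifferentiableAt ℝ A p := fun p hp =>
    (hA.contDiffAt (hU.mem_nhds hp)).differentiableAt (by simp)
  have hYa : ContDiffOn ℝ ∞ (opY fun p => A p ![1, 0, 0]) U :=
    ((hAe _).fderiv_of_isOpen hU le_rfl).clm_apply hYvec.contDiffOn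
  have hde : ∀ p ∈ U, ∀ e u, fderiv ℝ (fun p => A p e) p u = fderiv ℝ A p u e := by
    intro p hp e u
    rw [((hAdiff p hp).hasFDerivAt.clm_apply (hasFDerivAt_const e p)).fderiv]
    simp
  have hdY : ∀ p ∈ U, ∀ u, fderiv ℝ (fun p => A p ![0, p 0, 1]) p u
      = fderiv ℝ A p u ![0, p 0, 1] + u 0 * A p ![0, 1, 0] := by
    intro p hp u
    have hsplit : (fun p => A p ![0, p 0, 1])
        = fun p => p 0 * A p ![0, 1, 0] + A p ![0, 0, 1] := by
      ext p; rw [map_fin_three]; simp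
    have hd1 := fun e => ((hAe e).contDiffAt (hU.mem_nhds hp)).differentiableAt (by simp)
    rw [hsplit, (((hasFDerivAt_apply (𝕜 := ℝ) 0 p).fun_mul (hd1 ![0, 1, 0]).hasFDerivAt).fun_add
      (hd1 ![0, 0, 1]).hasFDerivAt).fderiv, map_fin_three (fderiv ℝ A p u)]
    simp [hde p hp]
    ring
  have hXb : ∀ p ∈ U, opX (fun p => A p ![0, p 0, 1]) p
      = A p ![0, 1, 0] + opY (fun p => A p ![1, 0, 0]) p := by
    intro p hp
    have h := hAB p hp ![1, 0, 0] ![0, p 0, 1]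
    simp [ruminTwoForm, coordWedge_apply] at h
    simp only [opX, opY]
    rw [hdY p hp, hde p hp]
    simp
    linarith
  have hdXb : ∀ p ∈ U, ∀ u, fderiv ℝ (opX fun p => A p ![0, p 0, 1]) p u
      = fderiv ℝ A p u ![0, 1, 0] + fderiv ℝ (opY fun p => A p ![1, 0, 0]) p u := by
    intro p hp u
    have h : (opX fun p => A p ![0, p 0, 1]) =ᶠ[𝓝 p]
        fun p => A p ![0, 1, 0] + opY (fun p => A p ![1, 0, 0]) p := by
      filter_upwards [hU.mem_nhds hp] with q hq using hXb q hq
    rw [h.fderiv_eq, fderiv_fun_add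
      (((hAe _).contDiffAt (hU.mem_nhds hp)).differentiableAt (by simp))
      ((hYa.contDiffAt (hU.mem_nhds hp)).differentiableAt (by simp)),
      add_apply, hde p hp]
  refine ⟨fun p => A p ![1, 0, 0], fun p => A p ![0, p 0, 1], hAe _, hAY, fun p hp => ⟨?_, ?_⟩⟩
  · have h := hAB p hp ![1, 0, 0] ![0, 1, 0]
    simp [ruminTwoForm, coordWedge_apply] at h
    rw [opX, hdXb p hp, opZ, hde p hp, ← h, opX]
    ring
  · have h := hAB p hp ![0, 1, 0] ![0, p 0, 1]
    simp [ruminTwoForm, coordWedge_apply] at h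
    rw [opY, opY, hdXb p hp, opZ, hdY p hp, ← h]
    simp
    ring
end

section
/- Let U ⊆ ℝ³ be a contractible open set. Then the Rumin complex for the Heisenberg distribution is exact at its final term: for every smooth function ρ : U → ℝ there exist smooth functions c, d : U → ℝ such that Xd + Yc = ρ on U. -/
open Set Filter Topology MeasureTheory

theorem ContDiff.intervalIntegral_param {P : Type*} [NormedAddCommGroup P] [NormedSpace ℝ P]
    {g : P → ℝ → ℝ} (hg : ContDiff ℝ (⊤ : ℕ∞) (fun z : P × ℝ => g z.1 z.2)) (a b : ℝ) :
    ContDiff ℝ (⊤ : ℕ∞) (fun x => ∫ t in a..b, g x t) := by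
  wlog hab : a ≤ b generalizing a b
  · simp_rw [intervalIntegral.integral_symm b a]
    exact (this b a (le_of_not_ge hab)).neg
  let χ : ContDiffBump (0 : ℝ) := ⟨|a| + |b| + 1, |a| + |b| + 2, by positivity, by linarith⟩
  let h : P → ℝ → ℝ := fun x u => χ u * g x (-u)
  have hh : ContDiff ℝ (⊤ : ℕ∞) (fun z : P × ℝ => h z.1 z.2) :=
    (χ.contDiff.comp contDiff_snd).mul (hg.comp (contDiff_fst.prodMk contDiff_snd.neg))
  have hloc : LocallyIntegrable ((Ioc a b).indicator fun _ : ℝ => (1 : ℝ)) volume :=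
    (locallyIntegrable_const (1 : ℝ)).indicator measurableSet_Ioc
  have key := contDiffOn_convolution_right_with_param (μ := volume) (n := ⊤)
    (ContinuousLinearMap.lsmul ℝ ℝ) (g := h) (s := univ) (k := Metric.closedBall 0 χ.rOut)
    isOpen_univ (isCompact_closedBall _ _)
    (fun p x _ hx => by
      have : χ x = 0 := by
        apply χ.zero_of_le_dist
        simpa using le_of_lt (not_le.1 (fun h => hx (Metric.mem_closedBall.2 h)))
      simp [h, this]) hloc hh.contDiffOn
  rw [univ_prod_univ, contDiffOn_univ] at key
  have := key.comp (contDiff_id.prodMk (contDiff_const (c := (0 : ℝ))))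
  convert this using 1
  ext x
  simp only [Function.comp, id, convolution, ContinuousLinearMap.lsmul_apply, smul_eq_mul]
  rw [intervalIntegral.integral_of_le hab, ← integral_indicator measurableSet_Ioc]
  congr 1
  ext t
  by_cases ht : t ∈ Ioc a b
  · have : χ (0 - t) = 1 := by
      apply χ.one_of_mem_closedBall
      have : |t| ≤ |a| + |b| + 1 := abs_le.2
        ⟨by linarith [neg_abs_le a, abs_nonneg b, ht.1], by linarith [le_abs_self b, abs_nonneg a, ht.2]⟩
      simpa [χ] using this
    simp [indicator_of_mem ht, h] at this ⊢
    simp [this]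
  · simp [indicator_of_notMem ht]

/-- Divergence of a vector field on `ℝ³`. -/
noncomputable def divergence (V : (Fin 3 → ℝ) → (Fin 3 → ℝ)) (x : Fin 3 → ℝ) : ℝ :=
  ∑ j, fderiv ℝ V x (Pi.single j 1) j

theorem divergence_radial {F : (Fin 3 → ℝ) → ℝ} {x : Fin 3 → ℝ} (q : Fin 3 → ℝ)
    (hF : DifferentiableAt ℝ F x) :
    divergence (fun y => F y • (y - q)) x = 3 * F x + fderiv ℝ F x (x - q) := by
  have h := (hF.hasFDerivAt.smul ((hasFDerivAt_id x).sub_const q)).fderiv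
  have e : (fun y => F y • (y - q)) = F • (fun y => id y - q) := rfl
  rw [divergence, e, h]
  have h2 : fderiv ℝ F x (x - q) = ∑ j, (x - q) j • fderiv ℝ F x (Pi.single j 1) := by
    conv_lhs => rw [pi_eq_sum_univ' (x - q), map_sum]
    simp
  rw [h2]
  simp [Fin.sum_univ_three]
  ring

/-- Coefficient of the radial primitive of `ρ dx∧dy∧dt` with vertex `q`, integrated from
the homothety of ratio `b` to the identity. -/
noncomputable def radialCoeff (ρ : (Fin 3 → ℝ) → ℝ) (q : Fin 3 → ℝ) (b : ℝ) (x : Fin 3 → ℝ) : ℝ :=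
  ∫ r in b..1, r ^ 2 * ρ (q + r • (x - q))

theorem contDiff_radialCoeff {ρ : (Fin 3 → ℝ) → ℝ} (hρ : ContDiff ℝ (⊤ : ℕ∞) ρ)
    (q : Fin 3 → ℝ) (b : ℝ) : ContDiff ℝ (⊤ : ℕ∞) (radialCoeff ρ q b) :=
  ContDiff.intervalIntegral_param (g := fun x r => r ^ 2 * ρ (q + r • (x - q)))
    ((contDiff_snd.pow 2).mul
      (hρ.comp (contDiff_const.add (contDiff_snd.smul (contDiff_fst.sub contDiff_const))))) b 1

theorem fderiv_radialCoeff {ρ : (Fin 3 → ℝ) → ℝ} (hρ : ContDiff ℝ (⊤ : ℕ∞) ρ)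
    (q : Fin 3 → ℝ) (b : ℝ) (x : Fin 3 → ℝ) :
    fderiv ℝ (radialCoeff ρ q b) x (x - q) =
      ρ x - b ^ 3 * ρ (q + b • (x - q)) - 3 * radialCoeff ρ q b x := by
  set h : ℝ → ℝ := fun r => r ^ 2 * ρ (q + r • (x - q)) with hh
  have hc : Continuous h := by
    have := hρ.continuous
    fun_prop
  have hline : HasDerivAt (fun s : ℝ => q + s • (x - q)) (x - q) 1 := by
    simpa using ((hasDerivAt_id (1 : ℝ)).smul_const (x - q)).const_add q
  have h1 : HasDerivAt (fun s : ℝ => radialCoeff ρ q b (q + s • (x - q)))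
      (fderiv ℝ (radialCoeff ρ q b) x (x - q)) 1 := by
    have hd : HasFDerivAt (radialCoeff ρ q b) (fderiv ℝ (radialCoeff ρ q b) x)
        (q + (1 : ℝ) • (x - q)) := by
      simpa using ((contDiff_radialCoeff hρ q b).differentiable (by simp) x).hasFDerivAt
    exact hd.comp_hasDerivAt 1 hline
  have h2 : HasDerivAt (fun s : ℝ => s ^ 3 * radialCoeff ρ q b (q + s • (x - q)))
      (3 * radialCoeff ρ q b x + fderiv ℝ (radialCoeff ρ q b) x (x - q)) 1 := by
    refine ((hasDerivAt_pow 3 (1 : ℝ)).fun_mul h1).congr_deriv ?_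
    norm_num
  have h3 : (fun s : ℝ => s ^ 3 * radialCoeff ρ q b (q + s • (x - q))) =
      fun s => (∫ r in 0..s, h r) - ∫ r in 0..(s * b), h r := by
    ext s
    rw [intervalIntegral.integral_interval_sub_left (hc.intervalIntegrable _ _)
      (hc.intervalIntegrable _ _)]
    have := intervalIntegral.smul_integral_comp_mul_left (a := b) (b := 1) h s
    rw [mul_one] at this
    rw [← this, radialCoeff, smul_eq_mul, ← intervalIntegral.integral_const_mul,
      ← intervalIntegral.integral_const_mul]
    congr 1
    ext r
    simp only [hh, add_sub_cancel_left, smul_smul, mul_comm s r]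
    ring
  have h4 : HasDerivAt (fun s => (∫ r in 0..s, h r) - ∫ r in 0..(s * b), h r)
      (h 1 - h b * b) 1 := by
    have e1 := intervalIntegral.integral_hasDerivAt_right (hc.intervalIntegrable 0 1)
      (hc.stronglyMeasurableAtFilter _ _) hc.continuousAt
    have e2 := intervalIntegral.integral_hasDerivAt_right (hc.intervalIntegrable 0 (1 * b))
      (hc.stronglyMeasurableAtFilter _ _) hc.continuousAt
    have e3 : HasDerivAt (fun s : ℝ => s * b) b 1 := by
      simpa using (hasDerivAt_id (1 : ℝ)).mul_const b
    have e4 := e2.comp (1 : ℝ) e3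
    rw [one_mul] at e4
    exact e1.fun_sub e4
  rw [h3] at h2
  have := h2.unique h4
  simp only [hh, one_pow, one_smul, one_mul, add_sub_cancel] at this
  linarith

theorem divergence_radialCoeff {ρ : (Fin 3 → ℝ) → ℝ} (hρ : ContDiff ℝ (⊤ : ℕ∞) ρ)
    (q : Fin 3 → ℝ) (b : ℝ) (x : Fin 3 → ℝ) :
    divergence (fun y => radialCoeff ρ q b y • (y - q)) x =
      ρ x - b ^ 3 * ρ (q + b • (x - q)) := by
  rw [divergence_radial q ((contDiff_radialCoeff hρ q b).differentiable (by simp) x),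
    fderiv_radialCoeff hρ]
  ring

theorem exists_outward_primitive {ρ : (Fin 3 → ℝ) → ℝ} (hρ : ContDiff ℝ (⊤ : ℕ∞) ρ) :
    ∃ V : (Fin 3 → ℝ) → (Fin 3 → ℝ), ContDiff ℝ (⊤ : ℕ∞) V ∧ (∀ x, divergence V x = ρ x) ∧
      ∀ x, V x ≠ 0 → ∃ r : ℝ, 0 ≤ r ∧ r ≤ 1 ∧ ρ (r • x) ≠ 0 := by
  refine ⟨fun y => radialCoeff ρ 0 0 y • (y - 0),
    (contDiff_radialCoeff hρ 0 0).smul (contDiff_id.sub contDiff_const), fun x => ?_, fun x => ?_⟩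
  · rw [divergence_radialCoeff hρ]
    simp
  · contrapose!
    intro h
    have : radialCoeff ρ 0 0 x = 0 := by
      refine (intervalIntegral.integral_congr (g := fun _ => (0 : ℝ)) fun r hr => ?_).trans (by simp)
      rw [uIcc_of_le zero_le_one] at hr
      simp [h r hr.1 hr.2]
    simp [this]

theorem exists_inward_primitive {ρ : (Fin 3 → ℝ) → ℝ} (hρ : ContDiff ℝ (⊤ : ℕ∞) ρ)
    (q : Fin 3 → ℝ) {R : ℝ} (hR : ∀ x, ρ x ≠ 0 → ‖x - q‖ ≤ R) :
    ∃ V : (Fin 3 → ℝ) → (Fin 3 → ℝ), ContDiffOn ℝ (⊤ : ℕ∞) V {q}ᶜ ∧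
      (∀ x, x ≠ q → divergence V x = ρ x) ∧
      ∀ x, V x ≠ 0 → ∃ r : ℝ, 1 ≤ r ∧ ρ (q + r • (x - q)) ≠ 0 := by
  set V : (Fin 3 → ℝ) → (Fin 3 → ℝ) := fun y =>
    (-∫ r in Ioi (1 : ℝ), r ^ 2 * ρ (q + r • (y - q))) • (y - q) with hV
  have key : ∀ x, x ≠ q → ∃ b : ℝ, ρ (q + b • (x - q)) = 0 ∧
      V =ᶠ[𝓝 x] fun y => radialCoeff ρ q b y • (y - q) := by
    intro x hx
    set η := ‖x - q‖ / 2 with hη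
    have hη0 : 0 < η := half_pos (norm_pos_iff.2 (sub_ne_zero.2 hx))
    have hvan : ∀ y, η < ‖y - q‖ → ∀ r, max 1 (R / η) ≤ r → ρ (q + r • (y - q)) = 0 := by
      intro y hy r hr
      by_contra hne
      have h1 := hR _ hne
      have hr0 : 0 < r := lt_of_lt_of_le one_pos ((le_max_left _ _).trans hr)
      rw [add_sub_cancel_left, norm_smul, Real.norm_of_nonneg hr0.le] at h1
      have h2 : R ≤ r * η := (div_le_iff₀ hη0).1 ((le_max_right _ _).trans hr)
      nlinarith
    refine ⟨max 1 (R / η), hvan x (by linarith) _ le_rfl, ?_⟩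
    have hopen : IsOpen {y | η < ‖y - q‖} :=
      isOpen_lt continuous_const (continuous_id.sub continuous_const).norm
    filter_upwards [hopen.mem_nhds (show η < ‖x - q‖ by linarith)] with y hy
    simp only [hV, radialCoeff]
    rw [intervalIntegral.integral_symm, intervalIntegral.integral_of_le (le_max_left _ _)]
    congr 2
    refine setIntegral_eq_of_subset_of_forall_sdiff_eq_zero measurableSet_Ioi Ioc_subset_Ioi_self ?_
    rintro r ⟨hr1, hr2⟩
    have : max 1 (R / η) ≤ r := by
      by_contra hlt
      exact hr2 ⟨hr1, (not_le.1 hlt).le⟩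
    simp [hvan y hy r this]
  refine ⟨V, fun x hx => ?_, fun x hx => ?_, fun x => ?_⟩
  · obtain ⟨b, -, hb⟩ := key x hx
    exact (((contDiff_radialCoeff hρ q b).smul
      (contDiff_id.sub contDiff_const)).contDiffAt.congr_of_eventuallyEq hb).contDiffWithinAt
  · obtain ⟨b, hb0, hb⟩ := key x hx
    rw [divergence, hb.fderiv_eq, ← divergence, divergence_radialCoeff hρ, hb0]
    simp
  · contrapose!
    intro h
    have : ∫ r in Ioi (1 : ℝ), r ^ 2 * ρ (q + r • (x - q)) = 0 :=
      setIntegral_eq_zero_of_forall_eq_zero fun r hr => by simp [h r (le_of_lt hr)]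
    simp [hV, this]

/-- A function supported near `p ∈ U` has a primitive on `U` whose support avoids compact subsets
of `U` as `p` leaves every compact subset of `U`. -/
theorem exists_primitive_of_support_subset {U : Set (Fin 3 → ℝ)} (hU : IsOpen U)
    (hne : Uᶜ.Nonempty) {p : Fin 3 → ℝ} {ρ : (Fin 3 → ℝ) → ℝ} (hρ : ContDiff ℝ (⊤ : ℕ∞) ρ) {s : ℝ}
    (hs : s ≤ 1) (hsp : s ≤ Metric.infDist p Uᶜ) (hsupp : ∀ x, ρ x ≠ 0 → dist x p ≤ s) :
    ∃ V : (Fin 3 → ℝ) → (Fin 3 → ℝ), ContDiffOn ℝ (⊤ : ℕ∞) V U ∧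
      (∀ x ∈ U, divergence V x = ρ x) ∧
      ∀ x, V x ≠ 0 → ‖p‖ ≤ ‖x‖ + 1 ∧ min (Metric.infDist x Uᶜ / 2) 1 ≤ Metric.infDist p Uᶜ := by
  rcases le_or_gt (Metric.infDist p Uᶜ) 1 with hδ | hδ
  · obtain ⟨q, hq, hpq⟩ := hU.isClosed_compl.exists_infDist_eq_dist hne p
    obtain ⟨V, hV, hdiv, hVs⟩ := exists_inward_primitive hρ q (R := s + dist p q) fun x hx => by
      rw [← dist_eq_norm]
      exact (dist_triangle x p q).trans (by gcongr; exact hsupp x hx)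
    have hUq : ∀ x ∈ U, x ≠ q := fun x hx h => hq (h ▸ hx)
    refine ⟨V, hV.mono hUq, fun x hx => hdiv x (hUq x hx), fun x hx => ?_⟩
    obtain ⟨r, hr, hne⟩ := hVs x hx
    have hxp : dist x p ≤ Metric.infDist p Uᶜ := by
      have hy : q + r • (x - q) ∈ Metric.closedBall p (Metric.infDist p Uᶜ) :=
        (hsupp _ hne).trans hsp
      have hq' : q ∈ Metric.closedBall p (Metric.infDist p Uᶜ) := by
        rw [hpq, dist_comm]
        exact Metric.mem_closedBall.2 le_rfl
      have hr0 : 0 < r := by linarith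
      have := (convex_closedBall p _).add_smul_sub_mem hq' hy
        (t := r⁻¹) ⟨by positivity, inv_le_one_of_one_le₀ hr⟩
      rwa [add_sub_cancel_left, smul_smul, inv_mul_cancel₀ hr0.ne', one_smul,
        add_sub_cancel] at this
    constructor
    · have := norm_le_norm_add_norm_sub' p x
      rw [← dist_eq_norm, dist_comm] at this
      linarith
    · have := Metric.infDist_le_infDist_add_dist (s := Uᶜ) (x := x) (y := p)
      exact (min_le_left _ _).trans (by linarith)
  · obtain ⟨V, hV, hdiv, hVs⟩ := exists_outward_primitive hρ
    refine ⟨V, hV.contDiffOn, fun x _ => hdiv x, fun x hx => ?_⟩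
    obtain ⟨r, hr0, hr1, hne⟩ := hVs x hx
    refine ⟨?_, (min_le_right _ _).trans hδ.le⟩
    have h1 := (hsupp _ hne).trans hs
    have h2 := norm_le_norm_add_norm_sub' p (r • x)
    rw [← dist_eq_norm, dist_comm] at h2
    have h3 : ‖r • x‖ ≤ ‖x‖ := by
      rw [norm_smul, Real.norm_of_nonneg hr0]
      exact mul_le_of_le_one_left (norm_nonneg _) hr1
    linarith

theorem exists_locallyFinite_ball_cover {U : Set (Fin 3 → ℝ)} (hU : IsOpen U)
    (hne : Uᶜ.Nonempty) :
    ∃ (ι : Type) (p : ι → (Fin 3 → ℝ)) (s : ι → ℝ),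
      (∀ i, p i ∈ U ∧ 0 < s i ∧ s i ≤ 1 ∧ s i < Metric.infDist (p i) Uᶜ) ∧
      (∀ x ∈ U, ∃ i, x ∈ Metric.ball (p i) (s i)) ∧
      ∀ K ⊆ U, IsCompact K → {i | (Metric.ball (p i) (s i) ∩ K).Nonempty}.Finite := by
  have hpos : ∀ x : U, 0 < Metric.infDist (x : Fin 3 → ℝ) Uᶜ := fun x =>
    (hU.isClosed_compl.notMem_iff_infDist_pos hne).1 (not_not.2 x.2)
  have hB : ∀ x : U, (𝓝 x).HasBasis
      (fun s : ℝ => 0 < s ∧ s < min 1 (Metric.infDist (x : Fin 3 → ℝ) Uᶜ)) (Metric.ball x) :=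
    fun x => by
      refine ⟨fun t => ⟨fun ht => ?_, ?_⟩⟩
      · obtain ⟨ε, hε, hεt⟩ := Metric.mem_nhds_iff.1 ht
        obtain ⟨s, hs0, hs⟩ := exists_between
          (lt_min hε (lt_min one_pos (hpos x)))
        exact ⟨s, ⟨hs0, hs.trans_le (min_le_right _ _)⟩,
          (Metric.ball_subset_ball (hs.le.trans (min_le_left _ _))).trans hεt⟩
      · rintro ⟨s, ⟨hs0, -⟩, hst⟩
        exact mem_of_superset (Metric.ball_mem_nhds x hs0) hst
  have : LocallyCompactSpace U := hU.locallyCompactSpace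
  obtain ⟨ι, c, s, hs, hcov, hfin⟩ := refinement_of_locallyCompact_sigmaCompact_of_nhds_basis hB
  refine ⟨ι, fun i => c i, s, fun i => ⟨(c i).2, (hs i).1, ?_, ?_⟩, fun x hx => ?_,
    fun K hKU hK => ?_⟩
  · exact (hs i).2.le.trans (min_le_left _ _)
  · exact (hs i).2.trans_le (min_le_right _ _)
  · have : (⟨x, hx⟩ : U) ∈ ⋃ i, Metric.ball (c i) (s i) := hcov ▸ mem_univ _
    obtain ⟨i, hi⟩ := mem_iUnion.1 this
    exact ⟨i, hi⟩
  · have hK' : IsCompact ((↑) ⁻¹' K : Set U) := by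
      rw [Subtype.isCompact_iff, Subtype.image_preimage_coe, inter_eq_right.2 hKU]
      exact hK
    refine (hfin.finite_nonempty_inter_compact hK').subset ?_
    rintro i ⟨x, hx, hxK⟩
    exact ⟨⟨x, hKU hxK⟩, hx, hxK⟩

theorem finsum_eventuallyEq_sum {ι X F : Type*} [TopologicalSpace X] [AddCommMonoid F]
    {v : ι → X → F} {x : X} {T : Finset ι} (h : ∀ᶠ y in 𝓝 x, ∀ i ∉ T, v i y = 0) :
    (fun y => ∑ᶠ i, v i y) =ᶠ[𝓝 x] fun y => ∑ i ∈ T, v i y := by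
  filter_upwards [h] with y hy
  refine finsum_eq_sum_of_support_subset _ fun i hi => ?_
  by_contra hT
  exact hi (hy i hT)

theorem contDiffOn_finsum {ι E F : Type*} [NormedAddCommGroup E] [NormedSpace ℝ E]
    [NormedAddCommGroup F] [NormedSpace ℝ F] {v : ι → E → F} {U : Set E}
    (hU : IsOpen U) (hv : ∀ i, ContDiffOn ℝ (⊤ : ℕ∞) (v i) U)
    (h : ∀ x ∈ U, ∃ T : Finset ι, ∀ᶠ y in 𝓝 x, ∀ i ∉ T, v i y = 0) :
    ContDiffOn ℝ (⊤ : ℕ∞) (fun y => ∑ᶠ i, v i y) U := by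
  intro x hx
  obtain ⟨T, hT⟩ := h x hx
  exact ((ContDiffAt.sum fun i _ =>
    (hv i).contDiffAt (hU.mem_nhds hx)).congr_of_eventuallyEq
      (finsum_eventuallyEq_sum hT)).contDiffWithinAt

theorem divergence_finsum {ι : Type*} {V : ι → (Fin 3 → ℝ) → (Fin 3 → ℝ)} {x : Fin 3 → ℝ}
    (hV : ∀ i, DifferentiableAt ℝ (V i) x)
    (h : ∃ T : Finset ι, ∀ᶠ y in 𝓝 x, ∀ i ∉ T, V i y = 0) :
    divergence (fun y => ∑ᶠ i, V i y) x = ∑ᶠ i, divergence (V i) x := by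
  obtain ⟨T, hT⟩ := h
  have hz : ∀ i ∉ T, divergence (V i) x = 0 := fun i hi => by
    have : V i =ᶠ[𝓝 x] fun _ => 0 := hT.mono fun y hy => hy i hi
    simp [divergence, this.fderiv_eq]
  rw [finsum_eq_sum_of_support_subset (s := T) _ fun i hi => by
    by_contra hT'
    exact hi (hz i hT')]
  simp only [divergence]
  rw [(finsum_eventuallyEq_sum hT).fderiv_eq, fderiv_fun_sum fun i _ => hV i, Finset.sum_comm]
  simp

theorem exists_divergence_eq {U : Set (Fin 3 → ℝ)} (hU : IsOpen U) {ρ : (Fin 3 → ℝ) → ℝ}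
    (hρ : ContDiffOn ℝ (⊤ : ℕ∞) ρ U) :
    ∃ V : (Fin 3 → ℝ) → (Fin 3 → ℝ), ContDiffOn ℝ (⊤ : ℕ∞) V U ∧
      ∀ x ∈ U, divergence V x = ρ x := by
  rcases Uᶜ.eq_empty_or_nonempty with hemp | hne
  · rw [compl_empty_iff.1 hemp] at hρ
    obtain ⟨V, hV, hdiv, -⟩ := exists_outward_primitive (contDiffOn_univ.1 hρ)
    exact ⟨V, hV.contDiffOn, fun x _ => hdiv x⟩
  obtain ⟨ι, p, s, hps, hcov, hfin⟩ := exists_locallyFinite_ball_cover hU hne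
  let f : ∀ i, ContDiffBump (p i) := fun i =>
    ⟨s i / 2, s i, half_pos (hps i).2.1, half_lt_self (hps i).2.1⟩
  have hfs : ∀ i x, f i x ≠ 0 → x ∈ Metric.ball (p i) (s i) := fun i x hx => by
    have : x ∈ Function.support (f i) := hx
    rwa [(f i).support_eq] at this
  have hball : ∀ i, Metric.closedBall (p i) (s i) ⊆ U := fun i x hx => by
    by_contra hxU
    have h1 := Metric.infDist_le_dist_of_mem (x := p i) (show x ∈ Uᶜ from hxU)
    rw [dist_comm] at h1
    exact absurd (h1.trans hx) (not_le.2 (hps i).2.2.2)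
  have hflf : ∀ x ∈ U, ∃ T : Finset ι, ∀ᶠ y in 𝓝 x, ∀ i ∉ T, f i y = 0 := fun x hx => by
    obtain ⟨K, hK, hxK, hKU⟩ := exists_compact_subset hU hx
    refine ⟨(hfin K hKU hK).toFinset, ?_⟩
    filter_upwards [mem_interior_iff_mem_nhds.1 hxK] with y hy i hi
    by_contra h
    exact hi ((hfin K hKU hK).mem_toFinset.2 ⟨y, hfs i y h, hy⟩)
  set S : (Fin 3 → ℝ) → ℝ := fun x => ∑ᶠ i, f i x
  have hS : ContDiffOn ℝ (⊤ : ℕ∞) S U :=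
    contDiffOn_finsum hU (fun i => (f i).contDiff.contDiffOn) hflf
  have hsuppfin : ∀ x ∈ U, (Function.support fun i => f i x).Finite := fun x hx => by
    obtain ⟨T, hT⟩ := hflf x hx
    refine T.finite_toSet.subset fun i hi => ?_
    by_contra h
    exact hi (hT.self_of_nhds i h)
  have hS0 : ∀ x ∈ U, S x ≠ 0 := fun x hx => by
    obtain ⟨i, hi⟩ := hcov x hx
    have h1 : 0 < f i x := (f i).pos_of_mem_ball hi
    exact (finsum_pos (fun j => (f j).nonneg) ⟨i, h1⟩ (hsuppfin x hx)).ne'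
  have hρi : ∀ i, ContDiff ℝ (⊤ : ℕ∞) fun x => f i x * (ρ x / S x) := fun i => by
    refine contDiff_iff_contDiffAt.2 fun x => ?_
    by_cases hx : x ∈ U
    · exact ((f i).contDiff.contDiffOn.mul (hρ.div hS hS0)).contDiffAt (hU.mem_nhds hx)
    · have hz : (fun x => f i x * (ρ x / S x)) =ᶠ[𝓝 x] fun _ => 0 := by
        filter_upwards [Metric.isClosed_closedBall.isOpen_compl.mem_nhds
          (fun h => hx (hball i h) : x ∈ (Metric.closedBall (p i) (s i))ᶜ)] with y hy
        have : f i y = 0 := by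
          by_contra h
          exact hy (Metric.ball_subset_closedBall (hfs i y h))
        rw [this, zero_mul]
      exact contDiffAt_const.congr_of_eventuallyEq hz
  choose V hV hdiv hVs using fun i => exists_primitive_of_support_subset hU hne (p := p i)
    (hρi i) (hps i).2.2.1 (hps i).2.2.2.le
    fun x hx => (Metric.mem_ball.1 (hfs i x (left_ne_zero_of_mul hx))).le
  have hVlf : ∀ x ∈ U, ∃ T : Finset ι, ∀ᶠ y in 𝓝 x, ∀ i ∉ T, V i y = 0 := fun x hx => by
    set ε := Metric.infDist x Uᶜ with hε
    have hε0 : 0 < ε := (hU.isClosed_compl.notMem_iff_infDist_pos hne).1 (not_not.2 hx)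
    set K : Set (Fin 3 → ℝ) :=
      Metric.closedBall 0 (‖x‖ + 2) ∩ {y | min (ε / 4) 1 ≤ Metric.infDist y Uᶜ}
    have hK : IsCompact K := (isCompact_closedBall _ _).inter_right
      (isClosed_le continuous_const (Metric.continuous_infDist_pt _))
    have hKU : K ⊆ U := fun y hy => by
      by_contra hyU
      have h1 : min (ε / 4) 1 ≤ Metric.infDist y Uᶜ := hy.2
      rw [Metric.infDist_zero_of_mem (show y ∈ Uᶜ from hyU)] at h1
      exact absurd h1 (not_le.2 (by positivity))
    refine ⟨(hfin K hKU hK).toFinset, ?_⟩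
    filter_upwards [Metric.ball_mem_nhds x (show 0 < min 1 (ε / 2) by positivity)] with y hy i hi
    by_contra h
    obtain ⟨h1, h2⟩ := hVs i y h
    have hy1 : dist y x < 1 := (Metric.mem_ball.1 hy).trans_le (min_le_left _ _)
    have hy2 : dist y x < ε / 2 := (Metric.mem_ball.1 hy).trans_le (min_le_right _ _)
    refine hi ((hfin K hKU hK).mem_toFinset.2
      ⟨p i, Metric.mem_ball_self (hps i).2.1, mem_closedBall_zero_iff.2 ?_, ?_⟩)
    · have := norm_le_norm_add_norm_sub' y x
      rw [← dist_eq_norm] at this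
      linarith
    · refine le_trans (min_le_min_right _ ?_) h2
      have := Metric.infDist_le_infDist_add_dist (s := Uᶜ) (x := x) (y := y)
      rw [dist_comm] at this
      linarith
  refine ⟨fun y => ∑ᶠ i, V i y, contDiffOn_finsum hU hV hVlf, fun x hx => ?_⟩
  rw [divergence_finsum (fun i => ((hV i).contDiffAt (hU.mem_nhds hx)).differentiableAt (by simp))
    (hVlf x hx), finsum_congr fun i => hdiv i x hx, ← finsum_mul]
  exact mul_div_cancel₀ _ (hS0 x hx)

theorem ContDiffOn.opX {f : (Fin 3 → ℝ) → ℝ} {U : Set (Fin 3 → ℝ)} (hU : IsOpen U)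
    (hf : ContDiffOn ℝ (⊤ : ℕ∞) f U) : ContDiffOn ℝ (⊤ : ℕ∞) (opX f) U :=
  (hf.fderiv_of_isOpen hU (by simp)).clm_apply contDiffOn_const

theorem ContDiffOn.opY {f : (Fin 3 → ℝ) → ℝ} {U : Set (Fin 3 → ℝ)} (hU : IsOpen U)
    (hf : ContDiffOn ℝ (⊤ : ℕ∞) f U) : ContDiffOn ℝ (⊤ : ℕ∞) (opY f) U := by
  refine (hf.fderiv_of_isOpen hU (by simp)).clm_apply (ContDiff.contDiffOn ?_)
  refine contDiff_pi.2 fun j => ?_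
  fin_cases j
  · exact contDiff_const
  · exact contDiff_apply ℝ ℝ (0 : Fin 3)
  · exact contDiff_const

theorem opX_add {f g : (Fin 3 → ℝ) → ℝ} {p : Fin 3 → ℝ} (hf : DifferentiableAt ℝ f p)
    (hg : DifferentiableAt ℝ g p) : opX (fun y => f y + g y) p = opX f p + opX g p := by
  simp [opX, fderiv_fun_add hf hg]

theorem opY_sub {f g : (Fin 3 → ℝ) → ℝ} {p : Fin 3 → ℝ} (hf : DifferentiableAt ℝ f p)
    (hg : DifferentiableAt ℝ g p) : opY (fun y => f y - g y) p = opY f p - opY g p := by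
  simp [opY, fderiv_fun_sub hf hg]

theorem opX_opY_sub_opY_opX {w : (Fin 3 → ℝ) → ℝ} {p : Fin 3 → ℝ}
    (hw : ContDiffAt ℝ (⊤ : ℕ∞) w p) : opX (opY w) p - opY (opX w) p = opZ w p := by
  have hd : DifferentiableAt ℝ (fderiv ℝ w) p :=
    (hw.fderiv_right (m := (⊤ : ℕ∞)) (by simp)).differentiableAt (by simp)
  have hsymm : IsSymmSndFDerivAt ℝ w p := hw.isSymmSndFDerivAt (by simpa using ENat.LEInfty.out)
  have hY : HasFDerivAt (fun y : Fin 3 → ℝ => (![0, y 0, 1] : Fin 3 → ℝ))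
      ((ContinuousLinearMap.proj (R := ℝ) (φ := fun _ : Fin 3 => ℝ) 0).smulRight ![0, 1, 0]) p := by
    refine hasFDerivAt_pi'.2 fun j => ?_
    fin_cases j
    · exact (hasFDerivAt_const (0 : ℝ) p).congr_fderiv (by ext; simp)
    · exact (hasFDerivAt_apply (0 : Fin 3) p).congr_fderiv (by ext; simp)
    · exact (hasFDerivAt_const (1 : ℝ) p).congr_fderiv (by ext; simp)
  have h1 := (hd.hasFDerivAt.clm_apply hY).fderiv
  have h2 := (hd.hasFDerivAt.clm_apply (hasFDerivAt_const (![1, 0, 0] : Fin 3 → ℝ) p)).fderiv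
  unfold opX opY opZ
  rw [h1, h2]
  have := hsymm ![1, 0, 0] ![0, p 0, 1]
  simp [this]

theorem divergence_eq_opX_add_opY_add_opZ {V : (Fin 3 → ℝ) → (Fin 3 → ℝ)} {p : Fin 3 → ℝ}
    (hV : DifferentiableAt ℝ V p) :
    divergence V p = opX (fun y => V y 0) p + opY (fun y => V y 2) p +
      opZ (fun y => V y 1 - y 0 * V y 2) p := by
  have hj : ∀ j, HasFDerivAt (fun y => V y j)
      ((ContinuousLinearMap.proj (R := ℝ) (φ := fun _ : Fin 3 => ℝ) j).comp (fderiv ℝ V p)) p :=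
    fun j => hasFDerivAt_pi'.1 hV.hasFDerivAt j
  have hw := ((hj 1).sub ((hasFDerivAt_apply (𝕜 := ℝ) (0 : Fin 3) p).mul (hj 2))).fderiv
  have e0 : (Pi.single 0 1 : Fin 3 → ℝ) = ![1, 0, 0] := by ext j; fin_cases j <;> simp
  have e1 : (Pi.single 1 1 : Fin 3 → ℝ) = ![0, 1, 0] := by ext j; fin_cases j <;> simp
  have e2 : (Pi.single 2 1 : Fin 3 → ℝ) = ![0, 0, 1] := by ext j; fin_cases j <;> simp
  have e3 : (![0, p 0, 1] : Fin 3 → ℝ) = p 0 • ![0, 1, 0] + ![0, 0, 1] := by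
    ext j; fin_cases j <;> simp
  have hz : opZ (fun y => V y 1 - y 0 * V y 2) p =
      fderiv ℝ V p ![0, 1, 0] 1 - p 0 * fderiv ℝ V p ![0, 1, 0] 2 := by
    refine (congrArg (fun L : (Fin 3 → ℝ) →L[ℝ] ℝ => L ![0, 1, 0]) hw).trans ?_
    simp
  rw [hz, divergence, opX, opY, (hj 0).fderiv, (hj 2).fderiv, Fin.sum_univ_three, e0, e1, e2, e3]
  simp only [ContinuousLinearMap.comp_apply, map_add, map_smul, ContinuousLinearMap.proj_apply,
    smul_eq_mul]
  ring

theorem heisenberg_rumin_exact_final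
    (U : Set (Fin 3 → ℝ)) (hU : IsOpen U) (hUc : ContractibleSpace U)
    (ρ : (Fin 3 → ℝ) → ℝ) (hρ : ContDiffOn ℝ (⊤ : ℕ∞) ρ U) :
    ∃ c d : (Fin 3 → ℝ) → ℝ, ContDiffOn ℝ (⊤ : ℕ∞) c U ∧ ContDiffOn ℝ (⊤ : ℕ∞) d U ∧
      ∀ p ∈ U, opX d p + opY c p = ρ p := by
  obtain ⟨V, hV, hdiv⟩ := exists_divergence_eq hU hρ
  have hVj : ∀ j, ContDiffOn ℝ (⊤ : ℕ∞) (fun y => V y j) U := fun j => contDiffOn_pi.1 hV j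
  set w : (Fin 3 → ℝ) → ℝ := fun y => V y 1 - y 0 * V y 2
  have hw : ContDiffOn ℝ (⊤ : ℕ∞) w U :=
    (hVj 1).sub ((contDiff_apply ℝ ℝ (0 : Fin 3)).contDiffOn.mul (hVj 2))
  refine ⟨fun y => V y 2 - opX w y, fun y => V y 0 + opY w y, (hVj 2).sub (hw.opX hU),
    (hVj 0).add (hw.opY hU), fun p hp => ?_⟩
  have hdiff : ∀ {F : Type} [NormedAddCommGroup F] [NormedSpace ℝ F] {f : (Fin 3 → ℝ) → F},
      ContDiffOn ℝ (⊤ : ℕ∞) f U → DifferentiableAt ℝ f p := fun hf =>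
    (hf.contDiffAt (hU.mem_nhds hp)).differentiableAt (by simp)
  rw [opX_add (hdiff (hVj 0)) (hdiff (hw.opY hU)), opY_sub (hdiff (hVj 2)) (hdiff (hw.opX hU)),
    ← hdiv p hp, divergence_eq_opX_add_opY_add_opZ (hdiff hV),
    ← opX_opY_sub_opY_opX (hw.contDiffAt (hU.mem_nhds hp))]
  ring
end
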